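/- For n, k ∈ ℕ with k > 1, the Dedekind-type count satisfies |A_{n+k}| = Σ_{α ≤ β, α,β ∈ A_n} |[⊥, α]| · P_{n,k,α,β} · |[β, ⊤]|, where P_{n,k,α,β} is the number of tuples (χ_P ∈ A_n | P ⊆ K), K = {n+1,…,n+k}, satisfying: χ_∅ = β, χ_K = α, ⋀_{i∈K} χ_{K\{i}} = α, ⋁_{i∈K} χ_{{i}} = β, and P ⊆ P' ⇒ χ_P ≥ χ_{P'} for all P, P' ⊆ K. -/

import Mathlib

/-!
Antichains of subsets of a finite universe
(following De Causmaecker & De Wannemacker,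
"On the number of antichains of sets in a finite universe").
-/

open scoped Classical

namespace Antichains

variable {V : Type*} [DecidableEq V]

/-- The `max` operator: keep only the non-dominated members of a family of sets. -/
def maxl (S : Finset (Finset V)) : Finset (Finset V) :=
  S.filter fun X => ∀ Y ∈ S, ¬X ⊂ Y

/-- `A` is an antichain of subsets: no two members are in a subset-superset relation. -/
def IsAC (A : Finset (Finset V)) : Prop :=
  ∀ X ∈ A, ∀ Y ∈ A, X ⊆ Y → X = Y

/-- The domination (partial) order on antichains: `acle A B` iff every member of `A`
is contained in some member of `B`. -/
def acle (A B : Finset (Finset V)) : Prop :=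
  ∀ X ∈ A, ∃ Y ∈ B, X ⊆ Y

/-- Strict domination. -/
def aclt (A B : Finset (Finset V)) : Prop :=
  acle A B ∧ ¬acle B A

/-- Join of antichains: `A ∨ B = max (A ∪ B)`. -/
def acjoin (A B : Finset (Finset V)) : Finset (Finset V) :=
  maxl (A ∪ B)

/-- Meet of antichains: `A ∧ B = max {X ∩ Y | X ∈ A, Y ∈ B}`. -/
def acmeet (A B : Finset (Finset V)) : Finset (Finset V) :=
  maxl ((A ×ˢ B).image fun p => p.1 ∩ p.2)

/-- `X⁻`: the antichain of immediate subsets of `X`. -/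
def im (X : Finset V) : Finset (Finset V) :=
  X.image fun x => X.erase x

/-- The interval poset `P_[a,b] = {X | a ∨ {X} ∈ (a,b]}`. -/
noncomputable def iposet [Fintype V] (a b : Finset (Finset V)) : Finset (Finset V) :=
  Finset.univ.filter fun X : Finset V => aclt a (acjoin a {X}) ∧ acle (acjoin a {X}) b

/-- `χ` belongs, as an antichain, to the interval `[a,b]`. -/
def memI (a b χ : Finset (Finset V)) : Prop :=
  IsAC χ ∧ acle a χ ∧ acle χ b

/-- Join of a finite family of antichains. -/
def bigJoin {ι : Type*} [DecidableEq ι] (s : Finset ι)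
    (f : ι → Finset (Finset V)) : Finset (Finset V) :=
  maxl (s.biUnion f)

/-- Meet of a finite family of antichains:
`⋀ᵢ f i = max {⋂ᵢ Aᵢ | Aᵢ ∈ f i}`. -/
noncomputable def bigMeet {ι : Type*} [DecidableEq ι] [Fintype ι] [Fintype V]
    (f : ι → Finset (Finset V)) : Finset (Finset V) :=
  maxl ((Finset.univ.filter fun g : ι → Finset V => ∀ i, g i ∈ f i).image
    fun g => Finset.univ.inf g)

/-- The number of antichains in the interval `[a, b]` of `A_n`. -/
noncomputable def intervalCard (n : ℕ) (a b : Finset (Finset (Fin n))) : ℕ :=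
  (Finset.univ.filter fun χ : Finset (Finset (Fin n)) =>
    IsAC χ ∧ acle a χ ∧ acle χ b).card

/-- The `P`-coefficient `P_{n,k,a,b}` (Definition 1 of the paper): the number of
order-reversing tuples `(χ_P ∈ A_n | P ⊆ K)`, `|K| = k`, with `χ_∅ = b`, `χ_K = a`,
`⋀_{i ∈ K} χ_{K \ {i}} = a` and `⋁_{i ∈ K} χ_{{i}} = b`. -/
noncomputable def Pcoeff (n k : ℕ) (a b : Finset (Finset (Fin n))) : ℕ :=
  (Finset.univ.filter fun χ : Finset (Fin k) → Finset (Finset (Fin n)) =>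
    (∀ P : Finset (Fin k), IsAC (χ P)) ∧
    χ ∅ = b ∧
    χ Finset.univ = a ∧
    bigMeet (fun i : Fin k => χ (Finset.univ.erase i)) = a ∧
    bigJoin Finset.univ (fun i : Fin k => χ {i}) = b ∧
    ∀ P P' : Finset (Fin k), P ⊆ P' → acle (χ P') (χ P)).card

set_option linter.unusedSectionVars false

section Order

lemma acle_refl (A : Finset (Finset V)) : acle A A := fun X hX => ⟨X, hX, subset_rfl⟩

lemma acle.trans {A B C : Finset (Finset V)} (hAB : acle A B) (hBC : acle B C) : acle A C := by
  intro X hX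
  obtain ⟨Y, hY, hXY⟩ := hAB X hX
  obtain ⟨Z, hZ, hYZ⟩ := hBC Y hY
  exact ⟨Z, hZ, hXY.trans hYZ⟩

lemma acle_of_subset {A B : Finset (Finset V)} (h : A ⊆ B) : acle A B :=
  fun X hX => ⟨X, h hX, subset_rfl⟩

lemma isAC_maxl (S : Finset (Finset V)) : IsAC (maxl S) := by
  intro X hX Y hY hXY
  rw [maxl, Finset.mem_filter] at hX hY
  by_contra hne
  exact hX.2 Y hY.1 (hXY.ssubset_of_ne hne)

lemma maxl_acle (S : Finset (Finset V)) : acle (maxl S) S :=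
  acle_of_subset (Finset.filter_subset _ _)

lemma acle_maxl (S : Finset (Finset V)) : acle S (maxl S) := by
  intro X hX
  obtain ⟨Y, hXY, hY⟩ := S.exists_le_maximal hX
  exact ⟨Y, Finset.mem_filter.2 ⟨hY.prop, fun Z hZ hYZ => hY.not_gt hZ hYZ⟩, hXY⟩

lemma IsAC.eq_of_acle {A B : Finset (Finset V)} (hA : IsAC A) (hB : IsAC B)
    (hAB : acle A B) (hBA : acle B A) : A = B := by
  have key : ∀ {C D : Finset (Finset V)}, IsAC C → acle C D → acle D C → C ⊆ D := by
    intro C D hC hCD hDC X hX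
    obtain ⟨Y, hY, hXY⟩ := hCD X hX
    obtain ⟨Z, hZ, hYZ⟩ := hDC Y hY
    obtain rfl := hC X hX Z hZ (hXY.trans hYZ)
    rwa [hXY.antisymm hYZ]
  exact (key hA hAB hBA).antisymm (key hB hBA hAB)

variable {ι : Type*} [DecidableEq ι]

lemma acle_bigJoin {s : Finset ι} {i : ι} (hi : i ∈ s) (f : ι → Finset (Finset V)) :
    acle (f i) (bigJoin s f) :=
  (acle_of_subset (Finset.subset_biUnion_of_mem f hi)).trans (acle_maxl _)

lemma bigJoin_acle {s : Finset ι} {f : ι → Finset (Finset V)} {B : Finset (Finset V)}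
    (h : ∀ i ∈ s, acle (f i) B) : acle (bigJoin s f) B := by
  refine (maxl_acle _).trans fun X hX => ?_
  obtain ⟨i, hi, hXi⟩ := Finset.mem_biUnion.1 hX
  exact h i hi X hXi

variable [Fintype ι] [Fintype V]

lemma bigMeet_acle (f : ι → Finset (Finset V)) (i : ι) : acle (bigMeet f) (f i) := by
  refine (maxl_acle _).trans fun X hX => ?_
  obtain ⟨g, hg, rfl⟩ := Finset.mem_image.1 hX
  exact ⟨g i, (Finset.mem_filter.1 hg).2 i, Finset.inf_le (Finset.mem_univ i)⟩

lemma acle_bigMeet {f : ι → Finset (Finset V)} {A : Finset (Finset V)}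
    (h : ∀ i, acle A (f i)) : acle A (bigMeet f) := by
  refine acle.trans (fun X hX => ?_) (acle_maxl _)
  choose g hg hXg using fun i => h i X hX
  exact ⟨Finset.univ.inf g,
    Finset.mem_image_of_mem _ (Finset.mem_filter.2 ⟨Finset.mem_univ _, hg⟩),
    Finset.le_inf fun i _ => hXg i⟩

end Order

section LowerSets

/-- Antichains of subsets correspond to lower sets of subsets, through the generated lower set. -/
noncomputable def isACEquivLowerSet (V : Type*) [DecidableEq V] [Fintype V] :
    {A : Finset (Finset V) // IsAC A} ≃ LowerSet (Finset V) where
  toFun A := lowerClosure (A.1 : Set (Finset V))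
  invFun L := ⟨maxl (Finset.univ.filter (· ∈ L)), isAC_maxl _⟩
  left_inv A := by
    refine Subtype.ext ((isAC_maxl _).eq_of_acle A.2 ((maxl_acle _).trans fun X hX => ?_)
      (acle.trans (fun X hX => ?_) (acle_maxl _)))
    · simpa using hX
    · exact ⟨X, by simpa using ⟨X, hX, subset_rfl⟩, subset_rfl⟩
  right_inv L := by
    ext X
    simp only [SetLike.mem_coe, mem_lowerClosure]
    constructor
    · rintro ⟨Y, hY, hXY⟩
      obtain ⟨Z, hZ, hYZ⟩ := maxl_acle _ Y hY
      exact L.lower (hXY.trans hYZ) (Finset.mem_filter.1 hZ).2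
    · intro hX
      exact acle_maxl _ X (by simpa using hX)

lemma isACEquivLowerSet_le_iff [Fintype V] (A B : {A : Finset (Finset V) // IsAC A}) :
    isACEquivLowerSet V A ≤ isACEquivLowerSet V B ↔ acle A.1 B.1 := by
  change lowerClosure (A.1 : Set (Finset V)) ≤ lowerClosure (B.1 : Set (Finset V)) ↔ _
  rw [lowerClosure_le]
  rfl

/-- Lower sets of a product correspond to antitone families of lower sets of the first factor. -/
def lowerSetProdEquiv (α β : Type*) [Preorder α] [Preorder β] :
    LowerSet (α × β) ≃ {f : β → LowerSet α // Antitone f} where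
  toFun L := ⟨fun b => ⟨{a | (a, b) ∈ L}, fun _ _ h ha => L.lower (Prod.mk_le_mk.2 ⟨h, le_rfl⟩) ha⟩,
    fun _ _ h _ ha => L.lower (Prod.mk_le_mk.2 ⟨le_rfl, h⟩) ha⟩
  invFun f := ⟨{p | p.1 ∈ f.1 p.2}, fun _ _ h hp => f.2 h.2 ((f.1 _).lower h.1 hp)⟩
  left_inv _ := rfl
  right_inv _ := rfl

/-- An equivalence of types induces an order isomorphism of their finite subsets. -/
def finsetOrderIso {α β : Type*} (e : α ≃ β) : Finset α ≃o Finset β where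
  toEquiv := e.finsetCongr
  map_rel_iff' := by simp

/-- Families of antichains indexed by subsets of `ι`, order-reversing for domination. -/
def IsRevFamily {ι : Type*} (χ : Finset ι → Finset (Finset V)) : Prop :=
  (∀ P, IsAC (χ P)) ∧ ∀ P P', P ⊆ P' → acle (χ P') (χ P)

/-- Antitone families of lower sets correspond to order-reversing families of antichains. -/
noncomputable def antitoneEquivRevFamily (V ι : Type*) [DecidableEq V] [Fintype V] :
    {f : Finset ι → LowerSet (Finset V) // Antitone f} ≃
      {χ : Finset ι → Finset (Finset V) // IsRevFamily χ} where
  toFun f := ⟨fun P => ((isACEquivLowerSet V).symm (f.1 P)).1, fun P => Subtype.prop _, by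
    intro P P' h
    simpa [← isACEquivLowerSet_le_iff] using f.2 h⟩
  invFun χ := ⟨fun P => isACEquivLowerSet V ⟨χ.1 P, χ.2.1 P⟩, fun P P' h =>
    (isACEquivLowerSet_le_iff _ _).2 (χ.2.2 P P' h)⟩
  left_inv f := by simp
  right_inv χ := by simp

lemma card_isAC_eq_card_isRevFamily (n k : ℕ) :
    (Finset.univ.filter fun χ : Finset (Finset (Fin (n + k))) => IsAC χ).card =
      (Finset.univ.filter fun χ : Finset (Fin k) → Finset (Finset (Fin n)) =>
        IsRevFamily χ).card := by
  rw [← Fintype.card_subtype, ← Fintype.card_subtype]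
  exact Fintype.card_congr <| (isACEquivLowerSet _).trans <|
    (LowerSet.map ((finsetOrderIso finSumFinEquiv.symm).trans Finset.sumEquiv)).toEquiv.trans <|
    (lowerSetProdEquiv _ _).trans (antitoneEquivRevFamily _ _)

end LowerSets

section Ends

variable {ι : Type*} [DecidableEq ι] [Fintype ι]

/-- Replace the values of a family at the full set and at the empty set. -/
def setEnds (x y : Finset (Finset V)) (χ : Finset ι → Finset (Finset V)) :
    Finset ι → Finset (Finset V) :=
  fun P => if P = Finset.univ then x else if P = ∅ then y else χ P

lemma setEnds_univ (x y : Finset (Finset V)) (χ : Finset ι → Finset (Finset V)) :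
    setEnds x y χ Finset.univ = x := if_pos rfl

lemma setEnds_empty [Nonempty ι] (x y : Finset (Finset V)) (χ : Finset ι → Finset (Finset V)) :
    setEnds x y χ ∅ = y := by
  simp [setEnds, Finset.univ_nonempty.ne_empty.symm]

lemma setEnds_of_ne {x y : Finset (Finset V)} {χ : Finset ι → Finset (Finset V)} {P : Finset ι}
    (h : P ≠ Finset.univ) (h' : P ≠ ∅) : setEnds x y χ P = χ P := by
  simp [setEnds, h, h']

lemma setEnds_setEnds (x y x' y' : Finset (Finset V)) (χ : Finset ι → Finset (Finset V)) :
    setEnds x y (setEnds x' y' χ) = setEnds x y χ := by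
  ext1 P
  unfold setEnds
  split_ifs <;> rfl

lemma setEnds_self (χ : Finset ι → Finset (Finset V)) :
    setEnds (χ Finset.univ) (χ ∅) χ = χ := by
  ext1 P
  unfold setEnds
  split_ifs with h h' <;> simp [*]

lemma IsRevFamily.setEnds {x y : Finset (Finset V)} {χ : Finset ι → Finset (Finset V)}
    (hχ : IsRevFamily χ) (hx : IsAC x) (hy : IsAC y) (hxy : acle x y)
    (hxχ : ∀ P, P ≠ Finset.univ → acle x (χ P)) (hχy : ∀ P, P ≠ ∅ → acle (χ P) y) :
    IsRevFamily (setEnds x y χ) := by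
  refine ⟨fun P => ?_, fun P P' h => ?_⟩
  · unfold Antichains.setEnds
    split_ifs
    exacts [hx, hy, hχ.1 P]
  · unfold Antichains.setEnds
    split_ifs with h1 h2 h3 h4 h5 h6 h7 h8
    all_goals first
      | exact acle_refl _
      | exact hxy
      | exact hχ.2 P P' h
      | (apply hxχ; assumption)
      | (apply hχy; assumption)
      | (exfalso; simp_all)

variable [Nontrivial ι]

lemma singleton_ne_univ (i : ι) : ({i} : Finset ι) ≠ Finset.univ := by
  obtain ⟨j, hj⟩ := exists_ne i
  intro h
  exact hj (Finset.mem_singleton.1 (h ▸ Finset.mem_univ j))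

lemma univ_erase_ne_empty (i : ι) : (Finset.univ.erase i : Finset ι) ≠ ∅ := by
  obtain ⟨j, hj⟩ := exists_ne i
  exact Finset.ne_empty_of_mem (Finset.mem_erase.2 ⟨hj, Finset.mem_univ j⟩)

lemma univ_erase_ne_univ (i : ι) : (Finset.univ.erase i : Finset ι) ≠ Finset.univ :=
  (Finset.erase_ssubset (Finset.mem_univ i)).ne

/-- The join of a family over the singletons. -/
def upper (χ : Finset ι → Finset (Finset V)) : Finset (Finset V) :=
  bigJoin Finset.univ fun i => χ {i}

lemma upper_setEnds (x y : Finset (Finset V)) (χ : Finset ι → Finset (Finset V)) :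
    upper (setEnds x y χ) = upper χ := by
  simp only [upper, setEnds_of_ne (singleton_ne_univ _) (Finset.singleton_ne_empty _)]

lemma IsRevFamily.acle_upper {χ : Finset ι → Finset (Finset V)} (hχ : IsRevFamily χ)
    {P : Finset ι} (hP : P ≠ ∅) : acle (χ P) (upper χ) := by
  obtain ⟨i, hi⟩ := Finset.nonempty_iff_ne_empty.2 hP
  exact (hχ.2 _ _ (Finset.singleton_subset_iff.2 hi)).trans
    (acle_bigJoin (Finset.mem_univ i) fun i => χ {i})

lemma IsRevFamily.upper_acle {χ : Finset ι → Finset (Finset V)} (hχ : IsRevFamily χ) :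
    acle (upper χ) (χ ∅) :=
  bigJoin_acle fun _ _ => hχ.2 _ _ (Finset.empty_subset _)

variable [Fintype V]

/-- The meet of a family over the complements of singletons. -/
noncomputable def lower (χ : Finset ι → Finset (Finset V)) : Finset (Finset V) :=
  bigMeet fun i => χ (Finset.univ.erase i)

lemma lower_setEnds (x y : Finset (Finset V)) (χ : Finset ι → Finset (Finset V)) :
    lower (setEnds x y χ) = lower χ := by
  simp only [lower, setEnds_of_ne (univ_erase_ne_univ _) (univ_erase_ne_empty _)]

lemma IsRevFamily.lower_acle {χ : Finset ι → Finset (Finset V)} (hχ : IsRevFamily χ)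
    {P : Finset ι} (hP : P ≠ Finset.univ) : acle (lower χ) (χ P) := by
  obtain ⟨i, hi⟩ : ∃ i, i ∉ P := by
    by_contra! h
    exact hP (Finset.eq_univ_of_forall h)
  exact (bigMeet_acle (fun i => χ (Finset.univ.erase i)) i).trans
    (hχ.2 _ _ (Finset.subset_erase.2 ⟨Finset.subset_univ P, hi⟩))

lemma IsRevFamily.acle_lower {χ : Finset ι → Finset (Finset V)} (hχ : IsRevFamily χ) :
    acle (χ Finset.univ) (lower χ) :=
  acle_bigMeet fun _ => hχ.2 _ _ (Finset.subset_univ _)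

lemma IsRevFamily.lower_acle_upper {χ : Finset ι → Finset (Finset V)} (hχ : IsRevFamily χ) :
    acle (lower χ) (upper χ) := by
  obtain ⟨i⟩ : Nonempty ι := inferInstance
  exact (hχ.lower_acle (singleton_ne_univ i)).trans
    (hχ.acle_upper (Finset.singleton_ne_empty i))

end Ends

lemma acle_singleton_univ [Fintype V] (A : Finset (Finset V)) : acle A {Finset.univ} :=
  fun X _ => ⟨Finset.univ, Finset.mem_singleton_self _, X.subset_univ⟩

lemma empty_acle (A : Finset (Finset V)) : acle ∅ A := fun X hX => by simp at hX

lemma card_fiber_eq (n k : ℕ) (hk : 1 < k) (a b : Finset (Finset (Fin n)))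
    (ha : IsAC a) (hb : IsAC b) (hab : acle a b) :
    (Finset.univ.filter fun χ : Finset (Fin k) → Finset (Finset (Fin n)) =>
        IsRevFamily χ ∧ lower χ = a ∧ upper χ = b).card =
      intervalCard n ∅ a * Pcoeff n k a b * intervalCard n b {Finset.univ} := by
  have : Nontrivial (Fin k) := Fin.nontrivial_iff_two_le.2 hk
  rw [intervalCard, Pcoeff, intervalCard, ← Finset.card_product, ← Finset.card_product]
  refine Finset.card_nbij' (fun χ => ((χ Finset.univ, setEnds a b χ), χ ∅))
    (fun q => setEnds q.1.1 q.2 q.1.2) ?_ ?_ ?_ ?_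
  · intro χ hχ
    simp only [Finset.coe_filter, Finset.mem_univ, true_and, Set.mem_ofPred_eq] at hχ
    obtain ⟨hχ, rfl, rfl⟩ := hχ
    have h := hχ.setEnds ha hb hab (fun _ => hχ.lower_acle) (fun _ => hχ.acle_upper)
    simp only [Finset.coe_product, Finset.coe_filter, Finset.mem_univ, true_and, Set.mem_prod,
      Set.mem_ofPred_eq]
    exact ⟨⟨⟨hχ.1 _, empty_acle _, hχ.acle_lower⟩, h.1, setEnds_empty _ _ _, setEnds_univ _ _ _,
      lower_setEnds _ _ _, upper_setEnds _ _ _, h.2⟩, hχ.1 _, hχ.upper_acle,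
      acle_singleton_univ _⟩
  · rintro ⟨⟨x, χ⟩, y⟩ h
    simp only [Finset.coe_product, Finset.coe_filter, Finset.mem_univ, true_and, Set.mem_prod,
      Set.mem_ofPred_eq] at h ⊢
    obtain ⟨⟨⟨hx, -, hxa⟩, hAC, -, -, hl, hu, hrev⟩, hy, hby, -⟩ := h
    have hχ : IsRevFamily χ := ⟨hAC, hrev⟩
    change lower χ = a at hl
    change upper χ = b at hu
    refine ⟨hχ.setEnds hx hy (hxa.trans (hab.trans hby))
      (fun P hP => hxa.trans (hl ▸ hχ.lower_acle hP))
      (fun P hP => acle.trans (hu ▸ hχ.acle_upper hP) hby), ?_, ?_⟩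
    · rw [lower_setEnds, hl]
    · rw [upper_setEnds, hu]
  · intro χ _
    simp only [setEnds_setEnds, setEnds_self]
  · rintro ⟨⟨x, χ⟩, y⟩ h
    simp only [Finset.coe_product, Finset.coe_filter, Finset.mem_univ, true_and, Set.mem_prod,
      Set.mem_ofPred_eq] at h
    obtain ⟨⟨-, -, rfl, rfl, -⟩, -⟩ := h
    simp only [setEnds_setEnds, setEnds_self, setEnds_univ, setEnds_empty]

/-- Theorem 6 of the paper.  For `k > 1`, the Dedekind-type count
satisfies `|A_{n+k}| = ∑_{α ≤ β} |[⊥, α]| · P_{n,k,α,β} · |[β, ⊤]|`, the sum running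
over all pairs of antichains `α ≤ β` of subsets of `{1,…,n}`. -/
theorem statement19 (n k : ℕ) (hk : 1 < k) :
    (Finset.univ.filter fun χ : Finset (Finset (Fin (n + k))) => IsAC χ).card =
      ∑ p ∈ Finset.univ.filter
          (fun p : Finset (Finset (Fin n)) × Finset (Finset (Fin n)) =>
            IsAC p.1 ∧ IsAC p.2 ∧ acle p.1 p.2),
        intervalCard n ∅ p.1 * Pcoeff n k p.1 p.2 *
          intervalCard n p.2 {(Finset.univ : Finset (Fin n))} := by
  have : Nontrivial (Fin k) := Fin.nontrivial_iff_two_le.2 hk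
  rw [card_isAC_eq_card_isRevFamily, Finset.card_eq_sum_card_fiberwise
    (f := fun χ => (lower χ, upper χ)) (t := Finset.univ.filter
      (fun p : Finset (Finset (Fin n)) × Finset (Finset (Fin n)) =>
        IsAC p.1 ∧ IsAC p.2 ∧ acle p.1 p.2))]
  · refine Finset.sum_congr rfl fun p hp => ?_
    obtain ⟨ha, hb, hab⟩ := (Finset.mem_filter.1 hp).2
    rw [← card_fiber_eq n k hk p.1 p.2 ha hb hab, Finset.filter_filter]
    simp only [Prod.ext_iff]
  · intro χ hχ
    simp only [Finset.coe_filter, Finset.mem_univ, true_and, Set.mem_ofPred_eq] at hχ ⊢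
    exact ⟨isAC_maxl _, isAC_maxl _, hχ.lower_acle_upper⟩

end Antichains
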